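/- Let A be a free arrangement in V = K^ℓ with exp(A) = (d_1,…,d_ℓ) and let H ∈ A. Then the deletion A' := A \ {H} is free, or strictly plus-one generated with exponents POexp(A') = (d_1,…,d_ℓ) and level d = |A'| − |A^H|. -/

import Mathlib

open MvPolynomial

noncomputable section

attribute [local instance] Classical.propDecidable

namespace ArrPOG

variable (K : Type) [Field K] (ℓ : ℕ)

/-- A polynomial vector field on `K^ℓ`: `θ = Σ θᵢ ∂/∂xᵢ`, identified with its
coefficient vector `(θ₁,…,θ_ℓ)` in `S = K[x₁,…,x_ℓ]`. -/
abbrev Deriv : Type := Fin ℓ → MvPolynomial (Fin ℓ) K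

variable {K ℓ}

/-- The linear polynomial `α_H ∈ S` associated to a linear form `φ ∈ V*`. -/
def linPoly (φ : Module.Dual K (Fin ℓ → K)) : MvPolynomial (Fin ℓ) K :=
  ∑ i, MvPolynomial.C (φ (Pi.single i 1)) * MvPolynomial.X i

/-- `θ(α)` for a derivation `θ` and the linear form `α` given by `φ ∈ V*`. -/
def applyLin (θ : Deriv K ℓ) (φ : Module.Dual K (Fin ℓ → K)) : MvPolynomial (Fin ℓ) K :=
  ∑ i, MvPolynomial.C (φ (Pi.single i 1)) * θ i

/-- An arrangement: a finite set of hyperplanes (kernels of nonzero linear forms). -/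
def IsArrangement (A : Finset (Submodule K (Fin ℓ → K))) : Prop :=
  ∀ H ∈ A, ∃ φ : Module.Dual K (Fin ℓ → K), φ ≠ 0 ∧ LinearMap.ker φ = H

/-- Essential: the common intersection of all members is `0`. -/
def Essential (A : Finset (Submodule K (Fin ℓ → K))) : Prop :=
  A.inf id = ⊥

/-- Membership in the logarithmic derivation module `D(A)`:
`θ(α_H) ∈ S·α_H` for every `H ∈ A`. -/
def InD (A : Finset (Submodule K (Fin ℓ → K))) (θ : Deriv K ℓ) : Prop :=
  ∀ H ∈ A, ∀ φ : Module.Dual K (Fin ℓ → K), LinearMap.ker φ = H → linPoly φ ∣ applyLin θ φ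

/-- A derivation is homogeneous of degree `n` if all its coefficients are. -/
def HomogDeriv (θ : Deriv K ℓ) (n : ℕ) : Prop := ∀ i, (θ i).IsHomogeneous n

/-- `θ₁,…,θₙ` generate `D(A)` as an `S`-module. -/
def GeneratesD {n : ℕ} (A : Finset (Submodule K (Fin ℓ → K))) (θ : Fin n → Deriv K ℓ) : Prop :=
  (∀ i, InD A (θ i)) ∧
    ∀ η, InD A η → ∃ c : Fin n → MvPolynomial (Fin ℓ) K, η = ∑ i, c i • θ i

/-- `S`-linear independence of a family of derivations. -/
def IndepD {n : ℕ} (θ : Fin n → Deriv K ℓ) : Prop :=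
  ∀ c : Fin n → MvPolynomial (Fin ℓ) K, (∑ i, c i • θ i) = 0 → ∀ i, c i = 0

/-- `A` is free with exponents `e`: `D(A)` has a homogeneous basis of degrees `e i`. -/
def IsFreeExp (A : Finset (Submodule K (Fin ℓ → K))) (e : Fin ℓ → ℕ) : Prop :=
  ∃ θ : Fin ℓ → Deriv K ℓ, (∀ i, HomogDeriv (θ i) (e i)) ∧ GeneratesD A θ ∧ IndepD θ

/-- `A` is free. -/
def IsFree (A : Finset (Submodule K (Fin ℓ → K))) : Prop := ∃ e, IsFreeExp A e

/-- `A` is plus-one generated with exponents `e`, level `lev`, realized by the minimal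
homogeneous generators `θ₁,…,θ_ℓ, φ` whose unique syzygy is `Σ fᵢ•θᵢ + α•φ = 0`:
this encodes the minimal free resolution
`0 → S[-lev-1] → S[-lev] ⊕ (⊕ S[-eᵢ]) → D(A) → 0`. -/
def IsPOGWith (A : Finset (Submodule K (Fin ℓ → K))) (e : Fin ℓ → ℕ) (lev : ℕ)
    (θ : Fin ℓ → Deriv K ℓ) (φ : Deriv K ℓ)
    (f : Fin ℓ → MvPolynomial (Fin ℓ) K) (α : MvPolynomial (Fin ℓ) K) : Prop :=
  (∀ i, InD A (θ i)) ∧ InD A φ ∧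
  (∀ i, HomogDeriv (θ i) (e i)) ∧ HomogDeriv φ lev ∧
  (∀ η, InD A η → ∃ (c : Fin ℓ → MvPolynomial (Fin ℓ) K) (g : MvPolynomial (Fin ℓ) K),
      η = (∑ i, c i • θ i) + g • φ) ∧
  α.IsHomogeneous 1 ∧
  (∀ i, (f i).IsHomogeneous (lev + 1 - e i)) ∧
  (∀ i, MvPolynomial.constantCoeff (f i) = 0) ∧
  ((∑ i, f i • θ i) + α • φ = 0) ∧
  (¬ (α = 0 ∧ ∀ i, f i = 0)) ∧
  (∀ (g : Fin ℓ → MvPolynomial (Fin ℓ) K) (h : MvPolynomial (Fin ℓ) K),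
      ((∑ i, g i • θ i) + h • φ = 0) →
      ∃ q : MvPolynomial (Fin ℓ) K, (∀ i, g i = q * f i) ∧ h = q * α)

/-- Plus-one generated with exponents `e` and level `lev`. -/
def IsPOG (A : Finset (Submodule K (Fin ℓ → K))) (e : Fin ℓ → ℕ) (lev : ℕ) : Prop :=
  ∃ θ φ f α, IsPOGWith A e lev θ φ f α

/-- Strictly plus-one generated: the level coefficient `α` is nonzero. -/
def IsSPOG (A : Finset (Submodule K (Fin ℓ → K))) (e : Fin ℓ → ℕ) (lev : ℕ) : Prop :=
  ∃ θ φ f α, IsPOGWith A e lev θ φ f α ∧ α ≠ 0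

/-- The restriction `A^H = {L ⊓ H | L ∈ A \ {H}}`. -/
def restrict (A : Finset (Submodule K (Fin ℓ → K))) (H : Submodule K (Fin ℓ → K)) :
    Finset (Submodule K (Fin ℓ → K)) :=
  (A.erase H).image (fun L => L ⊓ H)

/-- The localization `A_X = {L ∈ A | X ⊆ L}`. -/
def localize (A : Finset (Submodule K (Fin ℓ → K))) (X : Submodule K (Fin ℓ → K)) :
    Finset (Submodule K (Fin ℓ → K)) :=
  A.filter (fun L => X ≤ L)

/-- The intersection lattice of `A`, inside the ambient space `T`. -/
def latticeOf (T : Submodule K (Fin ℓ → K)) (A : Finset (Submodule K (Fin ℓ → K))) :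
    Finset (Submodule K (Fin ℓ → K)) :=
  A.powerset.image (fun B => T ⊓ B.inf id)

/-- The Möbius function of the poset `L` (intersection lattice with top `T`). -/
def mob (T : Submodule K (Fin ℓ → K)) (L : Finset (Submodule K (Fin ℓ → K)))
    (X : Submodule K (Fin ℓ → K)) : ℤ :=
  if X = T then 1
  else - ∑ Y ∈ (L.filter fun Z => X < Z).attach, mob T L Y.1
termination_by (L.filter fun Z => X < Z).card
decreasing_by
  obtain ⟨Y, hY⟩ := Y
  simp only [Finset.mem_filter] at hY
  apply Finset.card_lt_card
  rw [Finset.ssubset_def]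
  constructor
  · intro Z hZ
    simp only [Finset.mem_filter] at hZ ⊢
    exact ⟨hZ.1, lt_trans hY.2 hZ.2⟩
  · intro hsub
    have h2 := hsub (Finset.mem_filter.mpr ⟨hY.1, hY.2⟩)
    simp only [Finset.mem_filter] at h2
    exact lt_irrefl Y h2.2

/-- The characteristic polynomial `χ(A;t) = Σ_{X ∈ L(A)} μ(X) t^{dim X}`
of an arrangement inside the ambient space `T`. -/
def charPoly (T : Submodule K (Fin ℓ → K)) (A : Finset (Submodule K (Fin ℓ → K))) :
    Polynomial ℤ :=
  ∑ X ∈ latticeOf T A,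
    Polynomial.C (mob T (latticeOf T A) X) * Polynomial.X ^ (Module.finrank K X)

/-- The Betti number `b_i(A)`: `χ(A;t) = Σ (-1)^i b_i(A) t^{ℓ-i}`. -/
def bNum (A : Finset (Submodule K (Fin ℓ → K))) (i : ℕ) : ℤ :=
  (-1) ^ i * (charPoly (⊤ : Submodule K (Fin ℓ → K)) A).coeff (ℓ - i)

/-- Evaluation of the Poincaré polynomial `π(A;t) = Σ μ(X) (-t)^{codim X}` at `t : ℚ`. -/
def poincareEval (A : Finset (Submodule K (Fin ℓ → K))) (t : ℚ) : ℚ :=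
  ∑ X ∈ latticeOf ⊤ A,
    (mob (⊤ : Submodule K (Fin ℓ → K)) (latticeOf ⊤ A) X : ℚ) *
      (-t) ^ (ℓ - Module.finrank K X)

/-- The Euler derivation `θ_E = Σ xᵢ ∂/∂xᵢ`. -/
def eulerD : Deriv K ℓ := fun i => MvPolynomial.X i

/-- `A` is locally free: `A_X` is free for every `X ∈ L(A)` other than `∩_{H∈A} H`. -/
def LocallyFree (A : Finset (Submodule K (Fin ℓ → K))) : Prop :=
  ∀ X ∈ latticeOf ⊤ A, X ≠ A.inf id → IsFree (localize A X)

/-- Transport a finite set of subspaces contained in `T` to `K^m` along a linear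
isomorphism `T ≃ K^m`. -/
def transport {m : ℕ} (T : Submodule K (Fin ℓ → K)) (eqv : T ≃ₗ[K] (Fin m → K))
    (A : Finset (Submodule K (Fin ℓ → K))) : Finset (Submodule K (Fin m → K)) :=
  A.image fun L => (L.comap T.subtype).map eqv.toLinearMap

/-- An arrangement inside the subspace `T` is free with exponents `e`, i.e. it is free
after identifying `T` with a coordinate space. -/
def RestrFreeExp {m : ℕ} (T : Submodule K (Fin ℓ → K))
    (A : Finset (Submodule K (Fin ℓ → K))) (e : Fin m → ℕ) : Prop :=
  ∃ eqv : T ≃ₗ[K] (Fin m → K), IsFreeExp (transport T eqv A) e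

/-- The multiset of exponents. -/
def expMS {n : ℕ} (e : Fin n → ℕ) : Multiset ℕ := Finset.univ.val.map e

/-- `D(A)` has projective dimension at most 1: some finite generating set has a free
(possibly zero) syzygy module, i.e. there is a free resolution
`0 → S^m → S^n → D(A) → 0`. -/
def PdimLEOne (A : Finset (Submodule K (Fin ℓ → K))) : Prop :=
  ∃ (n m : ℕ) (θ : Fin n → Deriv K ℓ) (r : Fin m → Fin n → MvPolynomial (Fin ℓ) K),
    GeneratesD A θ ∧
    (∀ j, (∑ i, r j i • θ i) = 0) ∧
    (∀ c : Fin n → MvPolynomial (Fin ℓ) K, (∑ i, c i • θ i) = 0 →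
      ∃ q : Fin m → MvPolynomial (Fin ℓ) K, ∀ i, c i = ∑ j, q j * r j i) ∧
    (∀ q : Fin m → MvPolynomial (Fin ℓ) K, (∀ i, (∑ j, q j * r j i) = 0) → ∀ j, q j = 0)

/-- `A` has a free filtration `∅ = A₀ ⊂ A₁ ⊂ ⋯ ⊂ A_n = A`, `|A_i| = i`, each `A_i` free. -/
def HasFreeFiltration (A : Finset (Submodule K (Fin ℓ → K))) : Prop :=
  ∃ c : ℕ → Finset (Submodule K (Fin ℓ → K)),
    c A.card = A ∧ (∀ i ≤ A.card, (c i).card = i ∧ IsFree (c i)) ∧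
    ∀ i < A.card, c i ⊆ c (i + 1)

/-- The intersection lattices of `A` and `B` are isomorphic: there is a bijection of
hyperplanes preserving the rank of every subset (equivalently, a lattice isomorphism). -/
def LatticeEquiv (A B : Finset (Submodule K (Fin ℓ → K))) : Prop :=
  ∃ σ : Submodule K (Fin ℓ → K) → Submodule K (Fin ℓ → K),
    Set.BijOn σ ↑A ↑B ∧
    ∀ T ⊆ A, Module.finrank K ((T.inf id : Submodule K (Fin ℓ → K))) =
      Module.finrank K (((T.image σ).inf id : Submodule K (Fin ℓ → K)))


def hmap {σ K : Type} [Field K] : MvPolynomial σ K →ₐ[K] Polynomial (MvPolynomial σ K) :=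
  aeval (fun i => Polynomial.C (X i) * Polynomial.X)

theorem hmap_coeff {σ K : Type} [Field K] (p : MvPolynomial σ K) (d : ℕ) :
    (hmap p).coeff d = homogeneousComponent d p := by
  induction p using MvPolynomial.monomial_add_induction_on generalizing d with
  | C a =>
    have : hmap (C a : MvPolynomial σ K) = Polynomial.C (C a) := by
      rw [hmap, aeval_C]; rfl
    rw [this, Polynomial.coeff_C, homogeneousComponent_of_mem (isHomogeneous_C σ a)]
  | monomial_add s a f hs ha ih => 
    rw [map_add, map_add, Polynomial.coeff_add, ih]
    congr 1
    have : hmap (monomial s a : MvPolynomial σ K) = Polynomial.C (monomial s a) * Polynomial.X ^ s.degree := by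
      rw [hmap, aeval_monomial, monomial_eq (s := s), map_mul]
      rw [Finsupp.prod, Finsupp.prod]
      simp only [mul_pow, Finset.prod_mul_distrib, map_prod, map_pow, Finset.prod_pow_eq_pow_sum]
      rw [mul_assoc]; rfl
    rw [this, Polynomial.coeff_C_mul_X_pow, homogeneousComponent_of_mem (isHomogeneous_monomial (n := s.degree) a rfl)]

theorem hmap_homog {σ K : Type} [Field K] {p : MvPolynomial σ K} {n : ℕ} (h : p.IsHomogeneous n) :
    hmap p = Polynomial.C p * Polynomial.X ^ n := by
  ext1 d
  rw [hmap_coeff, Polynomial.coeff_C_mul_X_pow, homogeneousComponent_of_mem h]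

theorem comp_mul {σ K : Type} [Field K] (c t : MvPolynomial σ K) {e : ℕ} (h : t.IsHomogeneous e) (N : ℕ) :
    homogeneousComponent N (c * t) = if e ≤ N then homogeneousComponent (N - e) c * t else 0 := by
  rw [← hmap_coeff, map_mul, hmap_homog h, ← mul_assoc, Polynomial.coeff_mul_X_pow', Polynomial.coeff_mul_C, hmap_coeff]

theorem hmap_inj {σ K : Type} [Field K] (p : MvPolynomial σ K) (h : hmap p = 0) : p = 0 := by
  rw [← sum_homogeneousComponent p]
  apply Finset.sum_eq_zero
  intro i _
  rw [← hmap_coeff, h]; simp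

theorem homog_of_mul {σ K : Type} [Field K] {p q : MvPolynomial σ K} {n : ℕ} (h : (p * q).IsHomogeneous n)
    (hne : p * q ≠ 0) : ∃ a b, a + b = n ∧ p.IsHomogeneous a ∧ q.IsHomogeneous b := by
  have hp : hmap p ≠ 0 := fun h => hne (by rw [hmap_inj _ h, zero_mul])
  have hq : hmap q ≠ 0 := fun h => hne (by rw [hmap_inj _ h, mul_zero])
  have key : hmap p * hmap q = Polynomial.C (p * q) * Polynomial.X ^ n := by
    rw [← map_mul, hmap_homog h]
  have k1 := Polynomial.natDegree_mul hp hq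
  have k2 := Polynomial.natTrailingDegree_mul hp hq
  rw [key, Polynomial.natDegree_C_mul_X_pow _ _ hne] at k1
  rw [key, Polynomial.C_mul_X_pow_eq_monomial, Polynomial.natTrailingDegree_monomial hne] at k2
  have k3 := Polynomial.natTrailingDegree_le_natDegree (hmap p)
  have k4 := Polynomial.natTrailingDegree_le_natDegree (hmap q)
  have gen : ∀ r : MvPolynomial σ K, (hmap r).natDegree = (hmap r).natTrailingDegree →
      r.IsHomogeneous (hmap r).natDegree := by
    intro r hr
    have : r = homogeneousComponent (hmap r).natDegree r := by
      conv_lhs => rw [← sum_homogeneousComponent r]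
      by_cases hd : (hmap r).natDegree < r.totalDegree + 1
      · apply Finset.sum_eq_single_of_mem _ (Finset.mem_range.2 hd)
        intro b _ hb
        rw [← hmap_coeff]
        rcases lt_or_gt_of_ne hb with hb | hb
        · exact Polynomial.coeff_eq_zero_of_lt_natTrailingDegree (hr ▸ hb)
        · exact Polynomial.coeff_eq_zero_of_natDegree_lt hb
      · rw [homogeneousComponent_eq_zero _ _ (by omega)]
        apply Finset.sum_eq_zero
        intro b hb
        rw [Finset.mem_range] at hb
        rw [← hmap_coeff]
        exact Polynomial.coeff_eq_zero_of_lt_natTrailingDegree (by omega)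
    conv_lhs => rw [this]
    exact homogeneousComponent_isHomogeneous _ _
  exact ⟨_, _, k1.symm, gen p (by omega), gen q (by omega)⟩

theorem prime_lin {σ K : Type} [Field K] {p : MvPolynomial σ K} (h : p.IsHomogeneous 1) (h0 : p ≠ 0) : Prime p := by
  rw [← irreducible_iff_prime]
  have ht := h.totalDegree h0
  apply irreducible_of_totalDegree_eq_one ht
  intro x hx
  rw [isUnit_iff_ne_zero]
  rintro rfl
  apply h0
  ext m
  simpa using hx m

theorem relprime_lin {σ K : Type} [Field K] {p q : MvPolynomial σ K} (hp : p.IsHomogeneous 1) (hp0 : p ≠ 0)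
    (hq : q.IsHomogeneous 1) (hq0 : q ≠ 0) (h : ∀ c : K, p ≠ C c * q) : IsRelPrime p q := by
  rw [(prime_lin hp hp0).irreducible.isRelPrime_iff_not_dvd]
  rintro ⟨r, hr⟩
  obtain ⟨a, b, hab, h1, h2⟩ := homog_of_mul (hr ▸ hq) (hr ▸ hq0)
  have : a = 1 := h1.inj_right hp hp0
  have hb : b = 0 := by omega
  subst hb
  have := totalDegree_eq_zero_iff_eq_C.1 (Nat.le_zero.1 h2.totalDegree_le)
  set c := coeff 0 r
  have hc : c ≠ 0 := by
    intro hc; apply hq0; rw [hr, this, hc]; simp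
  apply h c⁻¹
  rw [hr, this, mul_comm p, ← mul_assoc, ← C_mul, inv_mul_cancel₀ hc]; simp

/-- a saturated rank one graded submodule of a free module is free of rank one. -/
theorem exists_prim {σ K : Type} [Field K] {n : ℕ} (a : Fin n → MvPolynomial σ K) (ha : a ≠ 0) :
    ∃ (g : MvPolynomial σ K) (f : Fin n → MvPolynomial σ K), g ≠ 0 ∧ (∀ i, a i = g * f i) ∧
      ∀ s t : MvPolynomial σ K, (∀ i, s ∣ t * f i) → s ∣ t := by
  classical
  obtain ⟨i0, hi0⟩ := Function.ne_iff.1 ha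
  let _ : StrongNormalizationMonoid (MvPolynomial σ K) := UniqueFactorizationMonoid.strongNormalizationMonoid
  let _ := UniqueFactorizationMonoid.toNormalizedGCDMonoid (MvPolynomial σ K)
  obtain ⟨f, hf, hg⟩ := Finset.extract_gcd (s := Finset.univ) a ⟨i0, Finset.mem_univ _⟩
  refine ⟨_, f, ?_, fun i => hf i (Finset.mem_univ i), ?_⟩
  · intro h
    have := hf i0 (Finset.mem_univ _)
    rw [h, zero_mul] at this
    exact hi0 this
  · intro s t h
    have := Finset.dvd_gcd (s := Finset.univ) (f := fun i => t * f i) (fun i _ => h i)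
    have h2 := Finset.gcd_mul_left' Finset.univ f t
    rw [hg, mul_one] at h2
    exact h2.dvd_iff_dvd_right.1 this

theorem linPoly_eval {K : Type} [Field K] {ℓ : ℕ} (φ : Module.Dual K (Fin ℓ → K)) (v : Fin ℓ → K) :
    eval v (linPoly φ) = φ v := by
  rw [linPoly, map_sum]
  conv_rhs => rw [← Finset.univ_sum_single v, map_sum]
  apply Finset.sum_congr rfl
  intro i _
  simp only [map_mul, eval_C, eval_X]
  have : (Pi.single i (v i) : Fin ℓ → K) = v i • Pi.single i 1 := by
    rw [← Pi.single_smul]; simp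
  rw [this, map_smul, smul_eq_mul, mul_comm]

theorem linPoly_homog {K : Type} [Field K] {ℓ : ℕ} (φ : Module.Dual K (Fin ℓ → K)) :
    (linPoly φ).IsHomogeneous 1 := by
  apply IsHomogeneous.sum
  intro i _
  exact isHomogeneous_C_mul_X _ _

theorem linPoly_inj {K : Type} [Field K] {ℓ : ℕ} {φ ψ : Module.Dual K (Fin ℓ → K)}
    (h : linPoly φ = linPoly ψ) : φ = ψ := by
  ext1 v
  ext1
  rw [LinearMap.comp_apply, LinearMap.comp_apply, ← linPoly_eval, h, linPoly_eval]

theorem linPoly_smul {K : Type} [Field K] {ℓ : ℕ} (c : K) (φ : Module.Dual K (Fin ℓ → K)) :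
    linPoly (c • φ) = C c * linPoly φ := by
  simp [linPoly, Finset.mul_sum, mul_assoc]

theorem linPoly_add {K : Type} [Field K] {ℓ : ℕ} (φ ψ : Module.Dual K (Fin ℓ → K)) :
    linPoly (φ + ψ) = linPoly φ + linPoly ψ := by
  simp [linPoly, add_mul, Finset.sum_add_distrib]

theorem linPoly_ne {K : Type} [Field K] {ℓ : ℕ} {φ : Module.Dual K (Fin ℓ → K)} (h : φ ≠ 0) :
    linPoly φ ≠ 0 := by
  intro h0
  apply h
  apply linPoly_inj
  rw [h0]; simp [linPoly]

theorem applyLin_smul {K : Type} [Field K] {ℓ : ℕ} (c : K) (θ : Deriv K ℓ) (φ : Module.Dual K (Fin ℓ → K)) :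
    applyLin θ (c • φ) = C c * applyLin θ φ := by
  simp [applyLin, Finset.mul_sum, mul_assoc]

theorem applyLin_add {K : Type} [Field K] {ℓ : ℕ} (θ : Deriv K ℓ) (φ ψ : Module.Dual K (Fin ℓ → K)) :
    applyLin θ (φ + ψ) = applyLin θ φ + applyLin θ ψ := by
  simp [applyLin, add_mul, Finset.sum_add_distrib]

theorem applyLin_smulD {K : Type} [Field K] {ℓ : ℕ} (f : MvPolynomial (Fin ℓ) K) (θ : Deriv K ℓ)
    (φ : Module.Dual K (Fin ℓ → K)) : applyLin (f • θ) φ = f * applyLin θ φ := by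
  simp only [applyLin, Finset.mul_sum, Pi.smul_apply, smul_eq_mul]
  apply Finset.sum_congr rfl
  intro i _
  ring

theorem applyLin_addD {K : Type} [Field K] {ℓ : ℕ} (θ η : Deriv K ℓ)
    (φ : Module.Dual K (Fin ℓ → K)) : applyLin (θ + η) φ = applyLin θ φ + applyLin η φ := by
  simp [applyLin, mul_add, Finset.sum_add_distrib]

theorem applyLin_subD {K : Type} [Field K] {ℓ : ℕ} (θ η : Deriv K ℓ)
    (φ : Module.Dual K (Fin ℓ → K)) : applyLin (θ - η) φ = applyLin θ φ - applyLin η φ := by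
  simp [applyLin, mul_sub, Finset.sum_sub_distrib]

theorem applyLin_sumD {K : Type} [Field K] {ℓ n : ℕ} (c : Fin n → MvPolynomial (Fin ℓ) K)
    (θ : Fin n → Deriv K ℓ) (φ : Module.Dual K (Fin ℓ → K)) :
    applyLin (∑ i, c i • θ i) φ = ∑ i, c i * applyLin (θ i) φ := by
  let T : Deriv K ℓ →+ MvPolynomial (Fin ℓ) K := 
    AddMonoidHom.mk' (fun θ => applyLin θ φ) (fun a b => applyLin_addD a b φ)
  have : T (∑ i, c i • θ i) = ∑ i, T (c i • θ i) := map_sum _ _ _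
  refine this.trans ?_
  apply Finset.sum_congr rfl
  intro i _
  exact applyLin_smulD _ _ _

/-- linear dependence from kernels. -/
theorem ker_span {K : Type} [Field K] {ℓ : ℕ} {φ ψ α : Module.Dual K (Fin ℓ → K)}
    (h : LinearMap.ker φ ⊓ LinearMap.ker α ≤ LinearMap.ker ψ) : ∃ a b : K, ψ = a • φ + b • α := by
  have := mem_span_of_iInf_ker_le_ker (L := ![φ, α]) (K := ψ) (by
    refine le_trans ?_ h
    refine le_inf (iInf_le _ 0) (iInf_le _ 1))
  rw [Matrix.range_cons, Matrix.range_cons, Matrix.range_empty, Set.union_empty] at this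
  rw [Set.singleton_union, Submodule.mem_span_pair] at this
  obtain ⟨a, b, h⟩ := this
  exact ⟨a, b, h.symm⟩

theorem ker_prop {K : Type} [Field K] {ℓ : ℕ} {φ ψ : Module.Dual K (Fin ℓ → K)}
    (h : LinearMap.ker φ ≤ LinearMap.ker ψ) : ∃ c : K, ψ = c • φ := by
  obtain ⟨a, b, h⟩ := ker_span (φ := φ) (α := φ) (ψ := ψ) (by simpa using h)
  exact ⟨a + b, by rw [h, add_smul]⟩

theorem linPoly_relPrime {K : Type} [Field K] {ℓ : ℕ} {φ ψ : Module.Dual K (Fin ℓ → K)}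
    (hφ : φ ≠ 0) (hψ : ψ ≠ 0) (h : LinearMap.ker φ ≠ LinearMap.ker ψ) :
    IsRelPrime (linPoly φ) (linPoly ψ) := by
  apply relprime_lin (linPoly_homog _) (linPoly_ne hφ) (linPoly_homog _) (linPoly_ne hψ)
  intro c hc
  rw [← linPoly_smul] at hc
  have h2 := linPoly_inj hc
  have hc0 : c ≠ 0 := by
    rintro rfl
    exact hφ (by simpa using h2)
  apply h
  rw [h2, LinearMap.ker_smul _ _ hc0]

/-- The quotient of the polynomial ring by a linear form. -/
theorem exists_quot {K : Type} [Field K] {ℓ : ℕ} {φ : Module.Dual K (Fin ℓ → K)} (hφ : φ ≠ 0) :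
    ∃ (τ : Type) (ρ : MvPolynomial (Fin ℓ) K →ₐ[K] MvPolynomial τ K)
      (s : MvPolynomial τ K →ₐ[K] MvPolynomial (Fin ℓ) K),
      (∀ p, ρ (s p) = p) ∧ (∀ p, ρ p = 0 ↔ linPoly φ ∣ p) ∧
      (∀ p n, p.IsHomogeneous n → (ρ p).IsHomogeneous n) ∧
      (∀ p n, p.IsHomogeneous n → (s p).IsHomogeneous n) := by
  obtain ⟨k, hk⟩ : ∃ k, φ (Pi.single k 1) ≠ 0 := by
    by_contra hcon
    push Not at hcon
    apply hφ
    apply linPoly_inj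
    simp [linPoly, hcon]
  set c := φ (Pi.single k 1) with hc
  let w : MvPolynomial {i : Fin ℓ // i ≠ k} K := ∑ i : {i : Fin ℓ // i ≠ k}, C (φ (Pi.single i.1 1)) * X i
  let g : Fin ℓ → MvPolynomial {i : Fin ℓ // i ≠ k} K := fun i =>
    if h : i ≠ k then X ⟨i, h⟩ else C (-c⁻¹) * w
  let ρ : MvPolynomial (Fin ℓ) K →ₐ[K] MvPolynomial {i : Fin ℓ // i ≠ k} K := aeval g
  let s : MvPolynomial {i : Fin ℓ // i ≠ k} K →ₐ[K] MvPolynomial (Fin ℓ) K := rename Subtype.val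
  have hw : w.IsHomogeneous 1 := by
    apply IsHomogeneous.sum
    intro i _
    exact isHomogeneous_C_mul_X _ _
  have hlin : linPoly φ = C c * X k + s w := by
    rw [linPoly, Fintype.sum_eq_add_sum_subtype_ne _ k]
    congr 1
    simp [w, s]
  have hρs : ∀ p, ρ (s p) = p := by
    intro p
    have : (ρ.comp s) = AlgHom.id K _ := by
      apply MvPolynomial.algHom_ext
      intro i
      simp [ρ, s, g, i.2]
    exact congrArg (fun f => f p) this
  have hρl : ρ (linPoly φ) = 0 := by
    rw [hlin, map_add, hρs]
    simp only [ρ, map_mul, aeval_X, algHom_C, g]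
    simp only [ne_eq, not_true_eq_false, dite_false, algebraMap_eq]
    rw [← mul_assoc, ← C_mul]
    rw [mul_neg, mul_inv_cancel₀ hk]
    simp
  have hsr : ∀ p, linPoly φ ∣ p - s (ρ p) := by
    intro p
    induction p using MvPolynomial.induction_on with
    | C a => simp [ρ, s, algHom_C]
    | add p q hp hq =>
      rw [map_add, map_add, add_sub_add_comm]
      exact dvd_add hp hq
    | mul_X p i hp =>
      have hx : linPoly φ ∣ X i - s (ρ (X i)) := by
        by_cases hi : i = k
        · subst hi
          have : X i - s (ρ (X i)) = C c⁻¹ * linPoly φ := by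
            rw [hlin, mul_add, ← mul_assoc, ← C_mul, inv_mul_cancel₀ hk]
            simp [ρ, g, s]
          rw [this]
          exact dvd_mul_left _ _
        · simp [ρ, g, s, hi]
      rw [map_mul, map_mul]
      have : p * X i - s (ρ p) * s (ρ (X i)) = (p - s (ρ p)) * X i + s (ρ p) * (X i - s (ρ (X i))) := by ring
      rw [this]
      exact dvd_add (hp.mul_right _) (hx.mul_left _)
  refine ⟨_, ρ, s, hρs, ?_, ?_, ?_⟩
  · intro p
    constructor
    · intro h
      have := hsr p
      rwa [h, map_zero, sub_zero] at this
    · rintro ⟨q, rfl⟩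
      rw [map_mul, hρl, zero_mul]
  · intro p n hp
    have := hp.aeval g (n := 1) (by
      intro i
      by_cases hi : i = k
      · simp only [g, hi, ne_eq, not_true_eq_false, dite_false]
        exact hw.C_mul _
      · simp only [g, hi, ne_eq, not_false_eq_true, dite_true]
        exact isHomogeneous_X _ _)
    rw [one_mul] at this
    exact this
  · intro p n hp
    exact hp.rename_isHomogeneous

theorem InD_iff {K : Type} [Field K] {ℓ : ℕ} (A : Finset (Submodule K (Fin ℓ → K)))
    (fm : Submodule K (Fin ℓ → K) → Module.Dual K (Fin ℓ → K))
    (hfm : ∀ L ∈ A, fm L ≠ 0 ∧ LinearMap.ker (fm L) = L) (θ : Deriv K ℓ) :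
    InD A θ ↔ ∀ L ∈ A, linPoly (fm L) ∣ applyLin θ (fm L) := by
  constructor
  · intro h L hL
    exact h L hL _ (hfm L hL).2
  · intro h L hL φ hφ
    obtain ⟨c, hc⟩ := ker_prop (φ := φ) (ψ := fm L) (by rw [hφ, (hfm L hL).2])
    have hc0 : c ≠ 0 := by
      rintro rfl
      exact (hfm L hL).1 (by simpa using hc)
    have := h L hL
    rw [hc, linPoly_smul, applyLin_smul] at this
    have hu : IsUnit (C c : MvPolynomial (Fin ℓ) K) := (isUnit_iff_ne_zero.2 hc0).map C
    rw [hu.mul_left_dvd, hu.dvd_mul_left] at this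
    exact this

theorem core {K : Type} [Field K] {ℓ : ℕ} (A : Finset (Submodule K (Fin ℓ → K)))
    (fm : Submodule K (Fin ℓ → K) → Module.Dual K (Fin ℓ → K))
    (hfm : ∀ L ∈ A, fm L ≠ 0 ∧ LinearMap.ker (fm L) = L)
    (e : Fin ℓ → ℕ) (H : Submodule K (Fin ℓ → K)) (hH : H ∈ A)
    (θ : Fin ℓ → Deriv K ℓ) (hθ : ∀ i, HomogDeriv (θ i) (e i)) (hgen : GeneratesD A θ) (hind : IndepD θ)
    {τ : Type} (ρ : MvPolynomial (Fin ℓ) K →ₐ[K] MvPolynomial τ K)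
    (s : MvPolynomial τ K →ₐ[K] MvPolynomial (Fin ℓ) K)
    (hρs : ∀ p, ρ (s p) = p) (hker : ∀ p, ρ p = 0 ↔ linPoly (fm H) ∣ p)
    (hsh : ∀ p n, p.IsHomogeneous n → (s p).IsHomogeneous n)
    (hρh : ∀ p n, p.IsHomogeneous n → (ρ p).IsHomogeneous n)
    (hex : ∃ η, InD (A.erase H) η ∧ ρ (applyLin η (fm H)) ≠ 0) :
    ∃ (φ : Deriv K ℓ) (F : Fin ℓ → MvPolynomial (Fin ℓ) K) (lev : ℕ),
      InD (A.erase H) φ ∧ HomogDeriv φ lev ∧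
      (∀ i, F i = 0 ∨ ∃ d, d + e i = lev + 1 ∧ (F i).IsHomogeneous d) ∧
      (∑ i, F i • θ i = linPoly (fm H) • φ) ∧
      (∀ η, InD (A.erase H) η → ∃ (c : Fin ℓ → MvPolynomial (Fin ℓ) K) (g : MvPolynomial (Fin ℓ) K),
        η = (∑ i, c i • θ i) + g • φ) ∧
      (∀ (g : Fin ℓ → MvPolynomial (Fin ℓ) K) (h : MvPolynomial (Fin ℓ) K),
        ((∑ i, g i • θ i) + h • φ = 0) →
        ∃ q : MvPolynomial (Fin ℓ) K, (∀ i, g i = q * F i) ∧ h = q * (- linPoly (fm H))) ∧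
      (∃ i, F i ≠ 0) ∧ ρ (applyLin φ (fm H)) ≠ 0 := by
  set α := linPoly (fm H) with hα
  have hα0 : α ≠ 0 := linPoly_ne (hfm H hH).1
  have hαp : Prime α := prime_lin (linPoly_homog _) hα0
  have hfm' : ∀ L ∈ A.erase H, fm L ≠ 0 ∧ LinearMap.ker (fm L) = L :=
    fun L hL => hfm L (Finset.mem_of_mem_erase hL)
  have hρα : ρ α = 0 := (hker _).2 dvd_rfl
  -- membership
  have hA_iff : ∀ η, InD A η ↔ InD (A.erase H) η ∧ ρ (applyLin η (fm H)) = 0 := by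
    intro η
    rw [InD_iff A fm hfm, InD_iff _ fm hfm', hker]
    constructor
    · intro h
      exact ⟨fun L hL => h L (Finset.mem_of_mem_erase hL), h H hH⟩
    · rintro ⟨h1, h2⟩ L hL
      by_cases hLH : L = H
      · rw [hLH]; exact h2
      · exact h1 L (Finset.mem_erase.2 ⟨hLH, hL⟩)
  have hαD : ∀ η, InD (A.erase H) η → InD A (α • η) := by
    intro η hη
    rw [hA_iff]
    constructor
    · rw [InD_iff _ fm hfm'] at hη ⊢
      intro L hL
      rw [applyLin_smulD]
      exact (hη L hL).mul_left _
    · rw [applyLin_smulD, map_mul, hρα, zero_mul]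
  -- the kernel module
  let M : (Fin ℓ → MvPolynomial τ K) → Prop := fun a => ∀ j, ∑ i, a i * ρ (θ i j) = 0
  have hMD : ∀ a, M a → ∃ η, InD (A.erase H) η ∧ ∑ i, s (a i) • θ i = α • η := by
    intro a ha
    have h1 : ∀ j, α ∣ ∑ i, s (a i) * θ i j := by
      intro j
      rw [← hker, map_sum, ← ha j]
      apply Finset.sum_congr rfl
      intro i _
      rw [map_mul, hρs]
    choose η hη using h1
    have heq : ∑ i, s (a i) • θ i = α • η := by
      funext j
      rw [Pi.smul_apply, smul_eq_mul, ← hη j, Finset.sum_apply]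
      simp
    refine ⟨η, ?_, heq⟩
    rw [InD_iff _ fm hfm']
    intro L hL
    have h3 : linPoly (fm L) ∣ α * applyLin η (fm L) := by
      rw [← applyLin_smulD, ← heq, applyLin_sumD]
      apply Finset.dvd_sum
      intro i _
      exact ((InD_iff A fm hfm _).1 (hgen.1 i) L (Finset.mem_of_mem_erase hL)).mul_left _
    refine IsRelPrime.dvd_of_dvd_mul_left ?_ h3
    apply linPoly_relPrime (hfm' L hL).1 (hfm H hH).1
    rw [(hfm' L hL).2, (hfm H hH).2]
    exact (Finset.mem_erase.1 hL).1
  have hDM : ∀ (η : Deriv K ℓ) (c : Fin ℓ → MvPolynomial (Fin ℓ) K), α • η = ∑ i, c i • θ i → M (fun i => ρ (c i)) := by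
    intro η c h j
    have := congrArg (fun f => ρ (f j)) h
    simp only [Pi.smul_apply, smul_eq_mul, map_mul, hρα, zero_mul, Finset.sum_apply, map_sum] at this
    exact this.symm
  have hindep : ∀ c d : Fin ℓ → MvPolynomial (Fin ℓ) K, ∑ i, c i • θ i = ∑ i, d i • θ i → ∀ i, c i = d i := by
    intro c d h i
    have := hind (fun i => c i - d i) (by
      simp only [sub_smul, Finset.sum_sub_distrib, h, sub_self]) i
    exact sub_eq_zero.1 this
  have hzero : ∀ (a : Fin ℓ → MvPolynomial τ K) (η : Deriv K ℓ), InD (A.erase H) η → ∑ i, s (a i) • θ i = α • η →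
      ρ (applyLin η (fm H)) = 0 → a = 0 := by
    intro a η h1 h2 h3
    obtain ⟨c, hc⟩ := hgen.2 η ((hA_iff η).2 ⟨h1, h3⟩)
    have := hindep (fun i => s (a i)) (fun i => α * c i) (by
      rw [h2, hc, Finset.smul_sum]; simp only [mul_smul])
    funext i
    rw [← hρs (a i), this i, map_mul, hρα, zero_mul]; rfl
  have hrank : ∀ a b, M a → M b → a ≠ 0 → ∃ u v, u ≠ 0 ∧ ∀ i, u * b i = v * a i := by
    intro a b ha hb ha0
    obtain ⟨η, h1, h2⟩ := hMD a ha
    obtain ⟨ζ, h3, h4⟩ := hMD b hb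
    refine ⟨ρ (applyLin η (fm H)), ρ (applyLin ζ (fm H)), fun h => ha0 (hzero a η h1 h2 h), ?_⟩
    have hz := hzero (fun i => ρ (applyLin η (fm H)) * b i - ρ (applyLin ζ (fm H)) * a i)
      (s (ρ (applyLin η (fm H))) • ζ - s (ρ (applyLin ζ (fm H))) • η) ?_ ?_ ?_
    · intro i
      exact sub_eq_zero.1 (congrFun hz i)
    · rw [InD_iff _ fm hfm'] at h1 h3 ⊢
      intro L hL
      rw [applyLin_subD, applyLin_smulD, applyLin_smulD]
      exact dvd_sub ((h3 L hL).mul_left _) ((h1 L hL).mul_left _)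
    · simp only [map_sub, map_mul, sub_smul, mul_smul, Finset.sum_sub_distrib, ← Finset.smul_sum, h2, h4]
      rw [smul_sub, smul_comm α, smul_comm α]
    · rw [applyLin_subD, applyLin_smulD, applyLin_smulD]
      simp only [map_sub, map_mul, hρs]
      ring
  -- nonzero homogeneous element
  obtain ⟨η0, hη0, hη0'⟩ := hex
  obtain ⟨c0, hc0⟩ := hgen.2 _ (hαD η0 hη0)
  have hM0 := hDM η0 c0 hc0
  have hne0 : (fun i => ρ (c0 i)) ≠ 0 := by
    intro h
    have h1 : ∀ i, α ∣ c0 i := fun i => (hker _).1 (congrFun h i)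
    choose r hr using h1
    have h2 : η0 = ∑ i, r i • θ i := by
      have : α • η0 = α • ∑ i, r i • θ i := by
        rw [hc0, Finset.smul_sum]
        apply Finset.sum_congr rfl
        intro i _
        rw [smul_smul, ← hr i]
      exact smul_right_injective _ hα0 this
    apply hη0'
    rw [h2, applyLin_sumD, map_sum]
    apply Finset.sum_eq_zero
    intro i _
    rw [map_mul, ((hA_iff _).1 (hgen.1 i)).2, mul_zero]
  obtain ⟨i0, hi0⟩ := Function.ne_iff.1 hne0
  obtain ⟨d0, hd0⟩ : ∃ d, homogeneousComponent d (ρ (c0 i0)) ≠ 0 := by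
    by_contra hcon
    push Not at hcon
    apply hi0
    show ρ (c0 i0) = 0
    rw [← sum_homogeneousComponent (ρ (c0 i0))]
    exact Finset.sum_eq_zero fun i _ => hcon i
  let N := d0 + e i0
  let a : Fin ℓ → MvPolynomial τ K := fun i =>
    if e i ≤ N then homogeneousComponent (N - e i) (ρ (c0 i)) else 0
  have haM : M a := by
    intro j
    have := congrArg (homogeneousComponent N) (hM0 j)
    rw [map_sum, map_zero] at this
    rw [← this]
    apply Finset.sum_congr rfl
    intro i _
    rw [comp_mul _ _ (hρh _ _ (hθ i j))]
    simp only [a]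
    split_ifs <;> simp
  have ha0 : a i0 ≠ 0 := by
    have : a i0 = homogeneousComponent d0 (ρ (c0 i0)) := by simp [a, N]
    rw [this]; exact hd0
  obtain ⟨g, f, hg0, hgf, hprim⟩ := exists_prim a (fun h => ha0 (congrFun h i0))
  have hahom : ∀ i, a i = 0 ∨ ∃ d, d + e i = N ∧ (a i).IsHomogeneous d := by
    intro i
    by_cases hi : e i ≤ N
    · right
      refine ⟨N - e i, by omega, ?_⟩
      simp only [a, hi, if_true]
      exact homogeneousComponent_isHomogeneous _ _
    · left; simp [a, hi]
  have hg_hom : ∃ γ, g.IsHomogeneous γ := by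
    rcases hahom i0 with h | ⟨d, -, h⟩
    · exact absurd h ha0
    · rw [hgf] at h
      obtain ⟨x, y, -, hx, -⟩ := homog_of_mul h (hgf i0 ▸ ha0)
      exact ⟨x, hx⟩
  obtain ⟨γ, hγ⟩ := hg_hom
  have hfhom : ∀ i, f i = 0 ∨ ∃ d, d + e i + γ = N ∧ (f i).IsHomogeneous d := by
    intro i
    by_cases hi : a i = 0
    · left
      rw [hgf] at hi
      exact (mul_eq_zero.1 hi).resolve_left hg0
    · right
      obtain ⟨d, hd, h⟩ := (hahom i).resolve_left hi
      rw [hgf] at h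
      obtain ⟨x, y, hxy, hx, hy⟩ := homog_of_mul h (hgf i ▸ hi)
      have := hx.inj_right hγ hg0
      exact ⟨y, by omega, hy⟩
  have hfM : M f := by
    intro j
    have := haM j
    have h2 : g * ∑ i, f i * ρ (θ i j) = 0 := by
      rw [Finset.mul_sum, ← this]
      apply Finset.sum_congr rfl
      intro i _
      rw [hgf]; ring
    exact (mul_eq_zero.1 h2).resolve_left hg0
  have hfi0 : f i0 ≠ 0 := by
    intro h
    apply ha0
    rw [hgf, h, mul_zero]
  have hf0 : f ≠ 0 := fun h => hfi0 (congrFun h i0)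
  obtain ⟨φ, hφD, hφ⟩ := hMD f hfM
  have hβ : ρ (applyLin φ (fm H)) ≠ 0 := fun h => hf0 (hzero f φ hφD hφ h)
  have hFi0 : s (f i0) ≠ 0 := by
    intro h
    apply hfi0
    rw [← hρs (f i0), h, map_zero]
  have hαφ : ∀ j, (α * φ j).IsHomogeneous (N - γ) := by
    intro j
    have h1 := congrFun hφ j
    rw [Pi.smul_apply, smul_eq_mul] at h1
    rw [← h1, Finset.sum_apply]
    apply IsHomogeneous.sum
    intro i _
    rcases hfhom i with h | ⟨d, hd, h⟩
    · rw [h, map_zero, zero_smul]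
      exact isHomogeneous_zero _ _ _
    · have := (hsh _ _ h).mul (hθ i j)
      rw [show N - γ = d + e i by omega]
      exact this
  have hφj : ∀ j, φ j = 0 ∨ ∃ b, 1 + b = N - γ ∧ (φ j).IsHomogeneous b := by
    intro j
    by_cases h : φ j = 0
    · exact Or.inl h
    · right
      obtain ⟨x, y, hxy, hx, hy⟩ := homog_of_mul (hαφ j) (mul_ne_zero hα0 h)
      have := hx.inj_right (linPoly_homog _) hα0
      exact ⟨y, by omega, hy⟩
  have hφ0 : ∃ j, φ j ≠ 0 := by
    by_contra hcon
    push Not at hcon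
    apply hβ
    simp [applyLin, hcon]
  have hpos : 1 ≤ N - γ := by
    obtain ⟨j, hj⟩ := hφ0
    obtain ⟨b, hb, -⟩ := (hφj j).resolve_left hj
    omega
  refine ⟨φ, fun i => s (f i), N - γ - 1, hφD, ?_, ?_, hφ, ?_, ?_, ⟨i0, hFi0⟩, hβ⟩
  · intro j
    rcases hφj j with h | ⟨b, hb, h⟩
    · rw [h]; exact isHomogeneous_zero _ _ _
    · rw [show N - γ - 1 = b by omega]; exact h
  · intro i
    rcases hfhom i with h | ⟨d, hd, h⟩
    · left; simp [h]
    · right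
      exact ⟨d, by omega, hsh _ _ h⟩
  · intro η hη
    obtain ⟨c, hc⟩ := hgen.2 _ (hαD η hη)
    obtain ⟨u, v, hu, huv⟩ := hrank f (fun i => ρ (c i)) hfM (hDM η c hc) hf0
    obtain ⟨q, hq⟩ := hprim u v (fun i => ⟨_, (huv i).symm⟩)
    have hq2 : ∀ i, ρ (c i) = q * f i := by
      intro i
      apply mul_left_cancel₀ hu
      rw [huv i, hq]; ring
    have h1 : ∀ i, α ∣ c i - s q * s (f i) := by
      intro i
      rw [← hker, map_sub, map_mul, hρs, hρs, hq2, sub_self]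
    choose r hr using h1
    refine ⟨r, s q, ?_⟩
    apply smul_right_injective _ hα0
    show α • η = α • (∑ i, r i • θ i + s q • φ)
    rw [smul_add, smul_comm α (s q), ← hφ, hc, Finset.smul_sum, Finset.smul_sum, ← Finset.sum_add_distrib]
    apply Finset.sum_congr rfl
    intro i _
    rw [smul_smul, smul_smul, ← add_smul, ← hr i, sub_add_cancel]
  · intro g h hgh
    have h1 : ∑ i, (α * g i + h * s (f i)) • θ i = 0 := by
      have : α • (∑ i, g i • θ i + h • φ) = 0 := by rw [hgh, smul_zero]
      rw [smul_add, smul_comm α h, ← hφ, Finset.smul_sum, Finset.smul_sum, ← Finset.sum_add_distrib] at this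
      rw [← this]
      apply Finset.sum_congr rfl
      intro i _
      rw [smul_smul, smul_smul, ← add_smul]
    have h2 := hind _ h1
    have h3 : α ∣ h := by
      rw [← hker]
      have := congrArg ρ (h2 i0)
      rw [map_add, map_mul, map_mul, hρα, zero_mul, zero_add, map_zero, hρs] at this
      exact (mul_eq_zero.1 this).resolve_right hfi0
    obtain ⟨q, hq⟩ := h3
    refine ⟨-q, ?_, by rw [hq]; ring⟩
    intro i
    apply mul_left_cancel₀ hα0
    have := h2 i
    rw [hq] at this
    linear_combination this

theorem exists_test {K : Type} [Field K] {ℓ : ℕ} (A : Finset (Submodule K (Fin ℓ → K)))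
    (fm : Submodule K (Fin ℓ → K) → Module.Dual K (Fin ℓ → K))
    (hfm : ∀ L ∈ A, fm L ≠ 0 ∧ LinearMap.ker (fm L) = L)
    (H : Submodule K (Fin ℓ → K)) (hH : H ∈ A) (L₁ : Submodule K (Fin ℓ → K)) (hL₁ : L₁ ∈ A.erase H) :
    ∃ η, InD (A.erase H) η ∧ ∃ c : K, c ≠ 0 ∧
      applyLin η (fm H) = C c * ∏ L ∈ (A.erase H).erase L₁, linPoly (fm L) := by
  have hfm' : ∀ L ∈ A.erase H, fm L ≠ 0 ∧ LinearMap.ker (fm L) = L :=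
    fun L hL => hfm L (Finset.mem_of_mem_erase hL)
  obtain ⟨v, hv1, hvH⟩ : ∃ v, v ∈ L₁ ∧ v ∉ H := by
    by_contra hcon
    push Not at hcon
    have hle : LinearMap.ker (fm L₁) ≤ LinearMap.ker (fm H) := by
      rw [(hfm' L₁ hL₁).2, (hfm H hH).2]
      exact hcon
    obtain ⟨c, hc⟩ := ker_prop hle
    have hc0 : c ≠ 0 := by
      rintro rfl
      exact (hfm H hH).1 (by simpa using hc)
    have := LinearMap.ker_smul (fm L₁) c hc0
    rw [← hc, (hfm' L₁ hL₁).2, (hfm H hH).2] at this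
    exact (Finset.mem_erase.1 hL₁).1 this.symm
  have happ : ∀ φ : Module.Dual K (Fin ℓ → K), applyLin (fun i => C (v i) : Deriv K ℓ) φ = C (φ v) := by
    intro φ
    rw [← linPoly_eval, linPoly, applyLin, map_sum, map_sum]
    apply Finset.sum_congr rfl
    intro i _
    simp
  refine ⟨(∏ L ∈ (A.erase H).erase L₁, linPoly (fm L)) • (fun i => C (v i) : Deriv K ℓ), ?_, fm H v, ?_, ?_⟩
  · rw [InD_iff _ fm hfm']
    intro L hL
    rw [applyLin_smulD, happ]
    by_cases h : L = L₁
    · subst h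
      rw [← (hfm' L hL).2] at hv1
      rw [LinearMap.mem_ker.1 hv1]
      simp
    · exact (Finset.dvd_prod_of_mem (fun L => linPoly (fm L)) (Finset.mem_erase.2 ⟨h, hL⟩)).mul_right _
  · intro h
    apply hvH
    rw [← (hfm H hH).2]
    exact h
  · rw [applyLin_smulD, happ, mul_comm]

theorem degree_eq {K : Type} [Field K] {ℓ : ℕ} (A : Finset (Submodule K (Fin ℓ → K)))
    (fm : Submodule K (Fin ℓ → K) → Module.Dual K (Fin ℓ → K))
    (hfm : ∀ L ∈ A, fm L ≠ 0 ∧ LinearMap.ker (fm L) = L)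
    (H : Submodule K (Fin ℓ → K)) (hH : H ∈ A) (hne : (A.erase H).Nonempty)
    {τ : Type} (ρ : MvPolynomial (Fin ℓ) K →ₐ[K] MvPolynomial τ K)
    (hker : ∀ p, ρ p = 0 ↔ linPoly (fm H) ∣ p)
    (hρh : ∀ p n, p.IsHomogeneous n → (ρ p).IsHomogeneous n)
    (φ : Deriv K ℓ) (lev : ℕ) (hφ : InD (A.erase H) φ) (hφh : HomogDeriv φ lev)
    (hβ : ρ (applyLin φ (fm H)) ≠ 0)
    (hdvd : ∀ η, InD (A.erase H) η → ρ (applyLin φ (fm H)) ∣ ρ (applyLin η (fm H))) :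
    lev + (restrict A H).card = (A.erase H).card := by
  have hfm' : ∀ L ∈ A.erase H, fm L ≠ 0 ∧ LinearMap.ker (fm L) = L :=
    fun L hL => hfm L (Finset.mem_of_mem_erase hL)
  have hρα : ρ (linPoly (fm H)) = 0 := (hker _).2 dvd_rfl
  set A' := A.erase H with hA'
  set β := ρ (applyLin φ (fm H)) with hβdef
  let p : Submodule K (Fin ℓ → K) → MvPolynomial τ K := fun L => ρ (linPoly (fm L))
  have hp1 : ∀ L, (p L).IsHomogeneous 1 := fun L => hρh _ _ (linPoly_homog _)
  have hrp : ∀ L ∈ A', IsRelPrime (linPoly (fm L)) (linPoly (fm H)) := by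
    intro L hL
    apply linPoly_relPrime (hfm' L hL).1 (hfm H hH).1
    rw [(hfm' L hL).2, (hfm H hH).2]
    exact (Finset.mem_erase.1 hL).1
  have hp0 : ∀ L ∈ A', p L ≠ 0 := by
    intro L hL h
    have h1 := (hker _).1 h
    have h2 := (hrp L hL) h1 dvd_rfl
    exact (prime_lin (linPoly_homog _) (linPoly_ne (hfm H hH).1)).not_isUnit h2
  have hpp : ∀ L ∈ A', ∀ L' ∈ A', L ⊓ H ≠ L' ⊓ H → IsRelPrime (p L) (p L') := by
    intro L hL L' hL' hLL
    apply relprime_lin (hp1 _) (hp0 L hL) (hp1 _) (hp0 L' hL')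
    intro c hc
    have hc0 : c ≠ 0 := by
      rintro rfl
      exact hp0 L hL (by rw [hc]; simp)
    have h1 : linPoly (fm H) ∣ linPoly (fm L) - C c * linPoly (fm L') := by
      rw [← hker, map_sub, map_mul, algHom_C, algebraMap_eq]
      exact sub_eq_zero.2 hc
    obtain ⟨q, hq⟩ := h1
    have h2 : ∀ v ∈ H, fm L v = c * fm L' v := by
      intro v hv
      have := congrArg (eval v) hq
      rw [map_sub, map_mul, map_mul, eval_C, linPoly_eval, linPoly_eval, linPoly_eval] at this
      have h3 : fm H v = 0 := by
        rw [← (hfm H hH).2] at hv; exact hv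
      rw [h3, zero_mul] at this
      exact sub_eq_zero.1 this
    apply hLL
    ext v
    simp only [Submodule.mem_inf]
    constructor
    · rintro ⟨h3, h4⟩
      refine ⟨?_, h4⟩
      rw [← (hfm' L hL).2, LinearMap.mem_ker, h2 v h4] at h3
      rw [← (hfm' L' hL').2, LinearMap.mem_ker]
      exact (mul_eq_zero.1 h3).resolve_left hc0
    · rintro ⟨h3, h4⟩
      refine ⟨?_, h4⟩
      rw [← (hfm' L' hL').2, LinearMap.mem_ker] at h3
      rw [← (hfm' L hL).2, LinearMap.mem_ker, h2 v h4, h3, mul_zero]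
  -- representatives
  set R := restrict A H with hR
  have hrep : ∀ Y, ∃ L, Y ∈ R → L ∈ A' ∧ L ⊓ H = Y := by
    intro Y
    by_cases hY : Y ∈ R
    · obtain ⟨L, hL, h⟩ := Finset.mem_image.1 hY
      exact ⟨L, fun _ => ⟨hL, h⟩⟩
    · exact ⟨⊥, fun h => absurd h hY⟩
  choose r hr using hrep
  have hmaps : ∀ L ∈ A', L ⊓ H ∈ R := fun L hL => Finset.mem_image.2 ⟨L, hL, rfl⟩
  let T := R.image r
  have hTA : T ⊆ A' := by
    intro L hL
    obtain ⟨Y, hY, rfl⟩ := Finset.mem_image.1 hL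
    exact (hr Y hY).1
  have hTr : ∀ L ∈ T, r (L ⊓ H) = L := by
    intro L hL
    obtain ⟨Y, hY, rfl⟩ := Finset.mem_image.1 hL
    rw [(hr Y hY).2]
  have hTcard : T.card = R.card := by
    apply Finset.card_image_of_injOn
    intro Y hY Z hZ h
    have h1 := (hr Y hY).2
    have h2 := (hr Z hZ).2
    rw [← h1, ← h2, h]
  let B := ∏ L ∈ A' \ T, p L
  have hB0 : B ≠ 0 := Finset.prod_ne_zero_iff.2 fun L hL => hp0 L (Finset.mem_sdiff.1 hL).1
  have hBh : B.IsHomogeneous (A' \ T).card := by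
    have := IsHomogeneous.prod (A' \ T) p (fun _ => 1) (fun L _ => hp1 L)
    simpa using this
  have hBβ : B ∣ β := by
    have h1 : B = ∏ Y ∈ R, ∏ L ∈ A' \ T with L ⊓ H = Y, p L :=
      (Finset.prod_fiberwise_of_maps_to (fun L hL => hmaps L (Finset.mem_sdiff.1 hL).1) _).symm
    rw [h1]
    apply Finset.prod_dvd_of_isRelPrime
    · intro Y hY Z hZ hYZ
      show IsRelPrime _ _
      apply IsRelPrime.prod_left
      intro L hL
      apply IsRelPrime.prod_right
      intro L' hL'
      rw [Finset.mem_filter, Finset.mem_sdiff] at hL hL'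
      apply hpp L hL.1.1 L' hL'.1.1
      rw [hL.2, hL'.2]
      exact hYZ
    · intro Y hY
      have hrY := hr Y hY
      have h2 : (A' \ T).filter (fun L => L ⊓ H = Y) = (A'.filter (fun L => L ⊓ H = Y)).erase (r Y) := by
        ext L
        simp only [Finset.mem_filter, Finset.mem_sdiff, Finset.mem_erase]
        constructor
        · rintro ⟨⟨h1, h2⟩, h3⟩
          refine ⟨?_, h1, h3⟩
          rintro rfl
          exact h2 (Finset.mem_image_of_mem _ hY)
        · rintro ⟨h1, h2, h3⟩
          refine ⟨⟨h2, fun h4 => h1 ?_⟩, h3⟩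
          rw [← hTr L h4, h3]
      rw [h2]
      have h3 : (∏ L ∈ A'.filter (fun L => L ⊓ H = Y), linPoly (fm L)) ∣
          linPoly (fm H) * applyLin φ (fm (r Y)) - linPoly (fm (r Y)) * applyLin φ (fm H) := by
        apply Finset.prod_dvd_of_isRelPrime
        · intro L hL L' hL' hLL
          simp only [Finset.coe_filter, Set.mem_ofPred_eq] at hL hL'
          show IsRelPrime _ _
          apply linPoly_relPrime (hfm' L hL.1).1 (hfm' L' hL'.1).1
          rwa [(hfm' L hL.1).2, (hfm' L' hL'.1).2]
        · intro L hL
          rw [Finset.mem_filter] at hL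
          obtain ⟨a, b, hab⟩ := ker_span (φ := fm L) (α := fm H) (ψ := fm (r Y)) (by
            rw [(hfm' L hL.1).2, (hfm H hH).2, (hfm' _ hrY.1).2, hL.2]
            exact hrY.2.ge.trans inf_le_left)
          rw [hab, linPoly_add, applyLin_add, linPoly_smul, linPoly_smul, applyLin_smul, applyLin_smul]
          have h5 := (InD_iff A' fm hfm' φ).1 hφ L hL.1
          have h6 : linPoly (fm H) * (C a * applyLin φ (fm L) + C b * applyLin φ (fm H)) -
              (C a * linPoly (fm L) + C b * linPoly (fm H)) * applyLin φ (fm H) =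
              applyLin φ (fm L) * (C a * linPoly (fm H)) - linPoly (fm L) * (C a * applyLin φ (fm H)) := by
            ring
          rw [h6]
          exact dvd_sub (h5.mul_right _) (dvd_mul_right _ _)
      have h4 := map_dvd ρ h3
      rw [map_prod, map_sub, map_mul, map_mul, hρα, zero_mul, zero_sub, dvd_neg] at h4
      change (∏ L ∈ A'.filter (fun L => L ⊓ H = Y), p L) ∣ p (r Y) * β at h4
      rw [← Finset.mul_prod_erase _ p (Finset.mem_filter.2 hrY)] at h4
      exact (mul_dvd_mul_iff_left (hp0 _ hrY.1)).1 h4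
  obtain ⟨γ, hγ⟩ := hBβ
  have hγ0 : γ ≠ 0 := by
    rintro rfl
    exact hβ (by rw [hγ, mul_zero])
  have hγdvd : ∀ L₁ ∈ T, γ ∣ ∏ L ∈ T.erase L₁, p L := by
    intro L₁ hL₁
    obtain ⟨η, hη, c, hc, happ⟩ := exists_test A fm hfm H hH L₁ (hTA hL₁)
    have h1 := hdvd η hη
    rw [happ, map_mul, algHom_C, algebraMap_eq, ((isUnit_iff_ne_zero.2 hc).map C).dvd_mul_left, map_prod] at h1
    change β ∣ ∏ L ∈ A'.erase L₁, p L at h1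
    have h2 : A'.erase L₁ = (A' \ T) ∪ T.erase L₁ := by
      ext L
      simp only [Finset.mem_erase, Finset.mem_union, Finset.mem_sdiff]
      constructor
      · rintro ⟨h1, h2⟩
        by_cases h3 : L ∈ T
        · exact Or.inr ⟨h1, h3⟩
        · exact Or.inl ⟨h2, h3⟩
      · rintro (⟨h1, h2⟩ | ⟨h1, h2⟩)
        · exact ⟨fun h => h2 (h ▸ hL₁), h1⟩
        · exact ⟨h1, hTA h2⟩
    rw [h2, Finset.prod_union (Finset.disjoint_left.2 fun L h3 h4 =>
      (Finset.mem_sdiff.1 h3).2 (Finset.mem_of_mem_erase h4)), hγ] at h1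
    exact (mul_dvd_mul_iff_left hB0).1 h1
  have hγu : IsUnit γ := by
    by_contra hnu
    obtain ⟨i, hi, hiγ⟩ := WfDvdMonoid.exists_irreducible_factor hnu hγ0
    have hip := hi.prime
    obtain ⟨L₀, hL₀⟩ := hne
    have hT0 : r (L₀ ⊓ H) ∈ T := Finset.mem_image_of_mem _ (hmaps _ hL₀)
    obtain ⟨L, hL, hiL⟩ := (hip.dvd_finsetProd_iff _).1 (hiγ.trans (hγdvd _ hT0))
    have hLT := Finset.mem_of_mem_erase hL
    obtain ⟨L', hL', hiL'⟩ := (hip.dvd_finsetProd_iff _).1 (hiγ.trans (hγdvd _ hLT))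
    have hLT' := Finset.mem_of_mem_erase hL'
    refine hip.not_isUnit (hpp L (hTA hLT) L' (hTA hLT') ?_ hiL hiL')
    intro h
    apply (Finset.mem_erase.1 hL').1
    rw [← hTr L hLT, ← hTr L' hLT', h]
  have hβh : β.IsHomogeneous lev := by
    apply hρh
    apply IsHomogeneous.sum
    intro i _
    exact (hφh i).C_mul _
  have e1 := hβh.totalDegree hβ
  have e2 := hBh.totalDegree hB0
  have e3 := totalDegree_mul_of_isDomain hB0 hγ0
  rw [← hγ, e1, e2, (isUnit_iff_totalDegree_of_isReduced.1 hγu).2, Finset.card_sdiff_of_subset hTA] at e3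
  have := Finset.card_le_card hTA
  omega

theorem isFree_empty {K : Type} [Field K] {ℓ : ℕ} : IsFree (∅ : Finset (Submodule K (Fin ℓ → K))) := by
  have hs : ∀ c : Fin ℓ → MvPolynomial (Fin ℓ) K,
      ∑ i, c i • (Pi.single i 1 : Deriv K ℓ) = c := by
    intro c
    conv_rhs => rw [← Finset.univ_sum_single c]
    apply Finset.sum_congr rfl
    intro i _
    rw [← Pi.single_smul, smul_eq_mul, mul_one]
  refine ⟨fun _ => 0, fun i => Pi.single i 1, ?_, ⟨?_, ?_⟩, ?_⟩
  · intro i j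
    show (Pi.single i 1 : Deriv K ℓ) j |>.IsHomogeneous 0
    by_cases h : j = i
    · subst h
      rw [Pi.single_eq_same]; exact isHomogeneous_one _ _
    · rw [Pi.single_eq_of_ne h]; exact isHomogeneous_zero _ _ _
  · intro i L hL
    simp at hL
  · intro η _
    exact ⟨η, (hs η).symm⟩
  · intro c hc i
    rw [hs] at hc
    rw [hc]; rfl
/-- Theorem `del2`: if `A` is free with exponents `(d₁,…,d_ℓ)` and
`H ∈ A`, then `A' = A \ {H}` is free, or strictly plus-one generated with exponents
`(d₁,…,d_ℓ)` and level `d = |A'| - |A^H|`. -/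
theorem deletion_free_or_SPOG {K : Type} [Field K] {ℓ : ℕ}
    (A : Finset (Submodule K (Fin ℓ → K)))
    (hA : IsArrangement A) (hEss : Essential A)
    (e : Fin ℓ → ℕ) (hfree : IsFreeExp A e)
    (H : Submodule K (Fin ℓ → K)) (hH : H ∈ A) :
    IsFree (A.erase H) ∨
      ∃ d : ℕ, (d : ℤ) = ((A.erase H).card : ℤ) - ((restrict A H).card : ℤ) ∧
        IsSPOG (A.erase H) e d := by
  rcases Finset.eq_empty_or_nonempty (A.erase H) with hemp | hne
  · left
    rw [hemp]
    exact isFree_empty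
  have hch : ∀ L, ∃ φ : Module.Dual K (Fin ℓ → K), L ∈ A → φ ≠ 0 ∧ LinearMap.ker φ = L := by
    intro L
    by_cases hL : L ∈ A
    · obtain ⟨φ, h⟩ := hA L hL
      exact ⟨φ, fun _ => h⟩
    · exact ⟨0, fun h => absurd h hL⟩
  choose fm hfm using hch
  obtain ⟨θ, hθ, hgen, hind⟩ := hfree
  obtain ⟨τ, ρ, s, hρs, hker, hρh, hsh⟩ := exists_quot (hfm H hH).1
  have hα0 : linPoly (fm H) ≠ 0 := linPoly_ne (hfm H hH).1
  have hαp : Prime (linPoly (fm H)) := prime_lin (linPoly_homog _) hα0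
  have hex : ∃ η, InD (A.erase H) η ∧ ρ (applyLin η (fm H)) ≠ 0 := by
    obtain ⟨L₁, hL₁⟩ := hne
    obtain ⟨η, hη, c, hc, happ⟩ := exists_test A fm hfm H hH L₁ hL₁
    refine ⟨η, hη, ?_⟩
    rw [ne_eq, hker, happ, ((isUnit_iff_ne_zero.2 hc).map C).dvd_mul_left, hαp.dvd_finsetProd_iff]
    rintro ⟨L, hL, h⟩
    have hL' := Finset.mem_of_mem_erase hL
    have hLA := Finset.mem_of_mem_erase hL'
    refine hαp.not_isUnit (linPoly_relPrime (hfm H hH).1 (hfm L hLA).1 ?_ dvd_rfl h)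
    rw [(hfm L hLA).2, (hfm H hH).2]
    exact (Finset.mem_erase.1 hL').1.symm
  obtain ⟨φ, F, lev, hφ, hφh, hFh, hrel, hg, hsyz, ⟨i1, hi1⟩, hβ⟩ :=
    core A fm hfm e H hH θ hθ hgen hind ρ s hρs hker hsh hρh hex
  have hθ' : ∀ i, InD (A.erase H) (θ i) := fun i L hL =>
    hgen.1 i L (Finset.mem_of_mem_erase hL)
  have hrel' : (∑ i, F i • θ i) + (-linPoly (fm H)) • φ = 0 := by
    rw [hrel, neg_smul, add_neg_cancel]
  by_cases hconst : ∀ i, constantCoeff (F i) = 0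
  · right
    have hdeg := degree_eq A fm hfm H hH hne ρ hker hρh φ lev hφ hφh hβ (by
      intro η hη
      obtain ⟨c, g, h⟩ := hg η hη
      rw [h, applyLin_addD, applyLin_sumD, applyLin_smulD, map_add, map_sum, map_mul]
      rw [Finset.sum_eq_zero, zero_add]
      · exact dvd_mul_left _ _
      · intro i _
        rw [map_mul, (hker _).2 (hgen.1 i H hH _ (hfm H hH).2), mul_zero])
    refine ⟨lev, by omega, θ, φ, F, -linPoly (fm H), ⟨hθ', hφ, hθ, hφh, hg, (linPoly_homog _).neg,
      ?_, hconst, hrel', ?_, hsyz⟩, neg_ne_zero.2 hα0⟩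
    · intro i
      rcases hFh i with h | ⟨d, hd, h⟩
      · rw [h]; exact isHomogeneous_zero _ _ _
      · rw [show lev + 1 - e i = d by omega]; exact h
    · rintro ⟨h, -⟩
      exact hα0 (neg_eq_zero.1 h)
  · left
    push Not at hconst
    obtain ⟨i0, hi0⟩ := hconst
    obtain ⟨k, hk, hFk⟩ : ∃ k : K, k ≠ 0 ∧ F i0 = C k := by
      rcases hFh i0 with h | ⟨d, hd, h⟩
      · exact absurd (by rw [h, map_zero]) hi0
      · refine ⟨constantCoeff (F i0), hi0, ?_⟩
        have hd0 : d = 0 := by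
          by_contra hd0
          apply hi0
          rw [constantCoeff_eq]
          exact h.coeff_eq_zero (by simpa using Ne.symm hd0)
        subst hd0
        exact totalDegree_eq_zero_iff_eq_C.1 (Nat.le_zero.1 h.totalDegree_le)
    have hupd : ∀ c : Fin ℓ → MvPolynomial (Fin ℓ) K,
        ∑ i, c i • Function.update θ i0 φ i = ∑ i, Function.update c i0 0 i • θ i + c i0 • φ := by
      intro c
      rw [← Finset.add_sum_erase _ _ (Finset.mem_univ i0),
        ← Finset.add_sum_erase _ (fun i => Function.update c i0 0 i • θ i) (Finset.mem_univ i0)]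
      simp only [Function.update_self, zero_smul, zero_add]
      rw [add_comm]
      congr 1
      apply Finset.sum_congr rfl
      intro i hi
      have := (Finset.mem_erase.1 hi).1
      rw [Function.update_of_ne this, Function.update_of_ne this]
    refine ⟨Function.update e i0 lev, Function.update θ i0 φ, ?_, ⟨?_, ?_⟩, ?_⟩
    · intro i
      by_cases h : i = i0
      · subst h; simpa using hφh
      · simpa [h] using hθ i
    · intro i
      by_cases h : i = i0
      · subst h; simpa using hφ
      · simpa [h] using hθ' i
    · intro η hη
      obtain ⟨c, g, h⟩ := hg η hη
      let t : MvPolynomial (Fin ℓ) K := -(C k⁻¹ * c i0)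
      refine ⟨Function.update (fun i => c i + t * F i) i0 (g - t * linPoly (fm H)), ?_⟩
      rw [hupd]
      have h1 : Function.update (Function.update (fun i => c i + t * F i) i0
          (g - t * linPoly (fm H))) i0 0 = fun i => c i + t * F i := by
        rw [Function.update_idem]
        apply Function.update_eq_self_iff.2
        have : C k⁻¹ * C k = (1 : MvPolynomial (Fin ℓ) K) := by
          rw [← C_mul, inv_mul_cancel₀ hk, C_1]
        simp only [t]
        rw [hFk]
        linear_combination c i0 * this
      rw [h1, Function.update_self, h]
      simp only [add_smul, Finset.sum_add_distrib, mul_smul, ← Finset.smul_sum, hrel, sub_smul]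
      abel
    · intro c hc
      rw [hupd] at hc
      obtain ⟨q, hq1, hq2⟩ := hsyz _ _ hc
      have hq : q = 0 := by
        have := hq1 i0
        rw [Function.update_self, hFk] at this
        refine (mul_eq_zero.1 this.symm).resolve_right ?_
        simpa using hk
      intro i
      by_cases h : i = i0
      · rw [h, hq2, hq, zero_mul]
      · have := hq1 i
        rw [Function.update_of_ne h, hq, zero_mul] at this
        exact this

end ArrPOG
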